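/- There exists a constant C such that for every n ≥ 2 and each π ∈ {312, 132}, there is a deterministic single-pass streaming algorithm that solves π-PPM_n using at most C·√(n·log₂ n) bits of space, i.e., having at most 2^{C·√(n·log₂ n)} states. -/

import Mathlib

/-- `Contains τ π`: the sequence `τ` contains the pattern `π`, i.e. some subsequence of `τ`
is order-isomorphic to `π`. -/
def Contains (τ π : List ℕ) : Prop :=
  ∃ f : Fin π.length → Fin τ.length, StrictMono f ∧
    ∀ j l : Fin π.length, (τ.get (f j) < τ.get (f l) ↔ π.get j < π.get l)

/-- The increasing pattern `1 2 … k`. -/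
def IncPattern (k : ℕ) : List ℕ := List.range' 1 k

/-- The decreasing pattern `k (k-1) … 1`. -/
def DecPattern (k : ℕ) : List ℕ := (List.range' 1 k).reverse

/-- A pattern is a permutation of `[k] = {1,…,k}` where `k` is its length. -/
def IsPattern (π : List ℕ) : Prop := π.Perm (List.range' 1 π.length)

/-- `τ` is a permutation of `[n] = {1,…,n}`. -/
def IsPermOf (n : ℕ) (τ : List ℕ) : Prop := τ.Perm (List.range' 1 n)

/-- `τ` is a sequence of pairwise distinct values from `[n]`. -/
def IsDistinctSeqIn (n : ℕ) (τ : List ℕ) : Prop :=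
  τ.Nodup ∧ ∀ x ∈ τ, 1 ≤ x ∧ x ≤ n

/-- A deterministic single-pass streaming algorithm with state set `Q`:
initial state, accepting states, transition function. -/
structure StreamAlg (Q : Type) where
  q0 : Q
  F : Set Q
  t : Q → ℕ → Q

/-- The state reached by the algorithm after reading the input `τ`. -/
def StreamAlg.run {Q : Type} (A : StreamAlg Q) (τ : List ℕ) : Q :=
  τ.foldl A.t A.q0

/-- The algorithm accepts the input `τ`. -/
def StreamAlg.Accepts {Q : Type} (A : StreamAlg Q) (τ : List ℕ) : Prop :=
  A.run τ ∈ A.F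

/-- `A` solves `π`-PPM_n : it accepts a permutation `τ` of `[n]` iff `τ` contains `π`. -/
def SolvesPPM {Q : Type} (A : StreamAlg Q) (n : ℕ) (π : List ℕ) : Prop :=
  ∀ τ : List ℕ, IsPermOf n τ → (A.Accepts τ ↔ Contains τ π)

/-- `A` solves `π`-SequencePPM_n : it accepts a sequence `τ` of pairwise distinct values
from `[n]` iff `τ` contains `π`. -/
def SolvesSeqPPM {Q : Type} (A : StreamAlg Q) (n : ℕ) (π : List ℕ) : Prop :=
  ∀ τ : List ℕ, IsDistinctSeqIn n τ → (A.Accepts τ ↔ Contains τ π)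

theorem IsPermOf.isDistinctSeqIn {n : ℕ} {τ : List ℕ} (hτ : IsPermOf n τ) :
    IsDistinctSeqIn n τ := by
  refine ⟨hτ.nodup_iff.2 (List.nodup_range' ..), fun x hx => ?_⟩
  have := hτ.mem_iff.1 hx
  rw [List.mem_range'_1] at this
  omega

/-- An update rule on an arbitrary type yields a streaming algorithm, provided the states reached
on repetition-free sequences from `[n]` stay within a finite set `T`. -/
theorem exists_streamAlg_of_update {σ : Type} (step : σ → ℕ → σ) (s₀ : σ)
    (T : Finset σ) (F : Set σ) (n : ℕ) (π : List ℕ)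
    (hT : ∀ p : List ℕ, IsDistinctSeqIn n p → p.foldl step s₀ ∈ T)
    (hF : ∀ τ : List ℕ, IsPermOf n τ → (τ.foldl step s₀ ∈ F ↔ Contains τ π)) :
    ∃ (Q : Type) (inst : Fintype Q) (A : StreamAlg Q),
      SolvesPPM A n π ∧ @Fintype.card Q inst = T.card := by
  classical
  have h0 : s₀ ∈ T := hT [] ⟨List.nodup_nil, by simp⟩
  let A : StreamAlg T :=
    { q0 := ⟨s₀, h0⟩
      F := {q | q.1 ∈ F}
      t := fun q x => if h : step q.1 x ∈ T then ⟨step q.1 x, h⟩ else q }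
  have hrun : ∀ p : List ℕ, IsDistinctSeqIn n p → (A.run p).1 = p.foldl step s₀ := by
    intro p
    induction p using List.reverseRecOn with
    | nil => intro _; rfl
    | append_singleton p x ih =>
      intro hp
      have hp' : IsDistinctSeqIn n p :=
        ⟨(List.nodup_append.1 hp.1).1, fun y hy => hp.2 y (by simp [hy])⟩
      have hmem := hT _ hp
      have ih' := ih hp'
      simp only [StreamAlg.run, List.foldl_append, List.foldl_cons, List.foldl_nil] at *
      have hA : ∀ q : T, A.t q x = if h : step q.1 x ∈ T then ⟨step q.1 x, h⟩ else q :=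
        fun _ => rfl
      rw [hA, ih', dif_pos hmem]
  refine ⟨T, inferInstance, A, ?_, by simp⟩
  intro τ hτ
  rw [← hF τ hτ, ← hrun τ hτ.isDistinctSeqIn]
  rfl

theorem contains_312_iff (τ : List ℕ) :
    Contains τ [3, 1, 2] ↔ ∃ c a b, a < b ∧ b < c ∧ [c, a, b].Sublist τ := by
  constructor
  · rintro ⟨f, hf, h⟩
    refine ⟨τ.get (f 0), τ.get (f 1), τ.get (f 2), (h 1 2).2 (by decide), (h 2 0).2 (by decide), ?_⟩
    rw [List.sublist_iff_exists_fin_orderEmbedding_get_eq]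
    refine ⟨OrderEmbedding.ofStrictMono f hf, fun i => ?_⟩
    change Fin 3 at i
    fin_cases i <;> rfl
  · rintro ⟨c, a, b, hab, hbc, h⟩
    rw [List.sublist_iff_exists_fin_orderEmbedding_get_eq] at h
    obtain ⟨f, hf⟩ := h
    refine ⟨f, f.strictMono, fun j l => ?_⟩
    have hj := hf j
    have hl := hf l
    rw [← hj, ← hl]
    change Fin 3 at j l
    fin_cases j <;> fin_cases l <;> simp <;> omega

theorem contains_132_iff (τ : List ℕ) :
    Contains τ [1, 3, 2] ↔ ∃ c a b, b < a ∧ c < b ∧ [c, a, b].Sublist τ := by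
  constructor
  · rintro ⟨f, hf, h⟩
    refine ⟨τ.get (f 0), τ.get (f 1), τ.get (f 2), (h 2 1).2 (by decide), (h 0 2).2 (by decide), ?_⟩
    rw [List.sublist_iff_exists_fin_orderEmbedding_get_eq]
    refine ⟨OrderEmbedding.ofStrictMono f hf, fun i => ?_⟩
    change Fin 3 at i
    fin_cases i <;> rfl
  · rintro ⟨c, a, b, hab, hbc, h⟩
    rw [List.sublist_iff_exists_fin_orderEmbedding_get_eq] at h
    obtain ⟨f, hf⟩ := h
    refine ⟨f, f.strictMono, fun j l => ?_⟩
    have hj := hf j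
    have hl := hf l
    rw [← hj, ← hl]
    change Fin 3 at j l
    fin_cases j <;> fin_cases l <;> simp <;> omega

theorem isPermOf_map_complement {n : ℕ} {τ : List ℕ} (hτ : IsPermOf n τ) :
    IsPermOf n (τ.map (n + 1 - ·)) := by
  obtain ⟨hnd, hb⟩ := hτ.isDistinctSeqIn
  have hnd' : (τ.map (n + 1 - ·)).Nodup := by
    refine List.Nodup.map_on (fun x hx y hy hxy => ?_) hnd
    have := hb x hx
    have := hb y hy
    omega
  refine (List.perm_ext_iff_of_nodup hnd' (List.nodup_range' ..)).2 fun v => ?_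
  simp only [List.mem_map, List.mem_range'_1]
  constructor
  · rintro ⟨x, hx, rfl⟩
    have := hb x hx
    omega
  · intro hv
    refine ⟨n + 1 - v, hτ.mem_iff.2 ?_, by omega⟩
    rw [List.mem_range'_1]
    omega

theorem contains_map_complement_312_iff {n : ℕ} {τ : List ℕ} (hτ : IsPermOf n τ) :
    Contains (τ.map (n + 1 - ·)) [3, 1, 2] ↔ Contains τ [1, 3, 2] := by
  have hb := hτ.isDistinctSeqIn.2
  rw [contains_312_iff, contains_132_iff]
  constructor
  · rintro ⟨c, a, b, hab, hbc, h⟩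
    obtain ⟨l, hl, he⟩ := List.sublist_map_iff.1 h
    obtain ⟨c', l, rfl, rfl, hl₁⟩ := List.map_eq_cons_iff.1 he.symm
    obtain ⟨a', l, rfl, rfl, hl₂⟩ := List.map_eq_cons_iff.1 hl₁
    obtain ⟨b', l, rfl, rfl, hl₃⟩ := List.map_eq_cons_iff.1 hl₂
    obtain rfl := List.map_eq_nil_iff.1 hl₃
    exact ⟨c', a', b', by omega, by omega, hl⟩
  · rintro ⟨c, a, b, hab, hbc, h⟩
    have ha := hb a (h.subset (by simp))
    have hb' := hb b (h.subset (by simp))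
    have hc := hb c (h.subset (by simp))
    exact ⟨n + 1 - c, n + 1 - a, n + 1 - b, by omega, by omega, h.map (n + 1 - ·)⟩

/-- The memory of the `312`-detecting algorithm, for values cut into `K` blocks of length `B`. -/
structure BlockState (K : ℕ) where
  /-- whether an occurrence of `312` is known to be unavoidable -/
  found : Bool
  /-- the largest value read so far -/
  top : ℕ
  /-- how many values of each block have been read -/
  cnt : Fin K → ℕ
  /-- the least value of each block read after some value of a higher block -/
  low : Fin K → ℕ
  /-- the residues of the values read in the block of `top` -/
  seen : Finset ℕ

open Classical in
/-- Reading the value `x`. -/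
noncomputable def BlockState.step (B : ℕ) {K : ℕ} (s : BlockState K) (x : ℕ) : BlockState K where
  found := s.found || decide (x < s.top ∧
    ((∃ j : Fin K, x / B < j ∧ j < s.top / B ∧ s.cnt j < B) ∨
     (∃ v, x < v ∧ v < s.top ∧ v / B = s.top / B ∧ v % B ∉ s.seen) ∨
     (x / B < s.top / B ∧ ∃ j : Fin K, (j : ℕ) = x / B ∧ s.low j < x)))
  top := max s.top x
  cnt j := if (j : ℕ) = x / B then s.cnt j + 1 else s.cnt j
  low j := if (j : ℕ) = x / B ∧ x / B < s.top / B then min (s.low j) x else s.low j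
  seen := if s.top / B < x / B then {x % B}
    else if x / B = s.top / B then insert (x % B) s.seen else s.seen

/-- The memory before the first value is read. -/
def BlockState.start (n K : ℕ) : BlockState K where
  found := false
  top := 0
  cnt _ := 0
  low _ := n + 1
  seen := ∅

/-- The memory after reading `p`, specified in terms of `p`. -/
structure BlockState.Describes (n B : ℕ) {K : ℕ} (s : BlockState K) (p : List ℕ) : Prop where
  le_top : ∀ y ∈ p, y ≤ s.top
  top_mem : s.top ∈ p ∨ s.top = 0
  cnt_eq : ∀ j : Fin K, s.cnt j = (p.toFinset.filter (· / B = j)).card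
  low_le : ∀ j : Fin K, s.low j ≤ n + 1
  of_low_lt : ∀ (j : Fin K) (v : ℕ), s.low j < v → v ≤ n →
    ∃ c y, [c, y].Sublist p ∧ y / B = j ∧ y < v ∧ j < c / B
  low_le_of : ∀ (j : Fin K) (c y : ℕ), [c, y].Sublist p → y / B = j → j < c / B → s.low j ≤ y
  seen_subset : s.seen ⊆ Finset.range B
  mem_seen : ∀ v, v / B = s.top / B → (v % B ∈ s.seen ↔ v ∈ p)
  of_found : s.found = true →
    ∃ c a b, a < b ∧ b < c ∧ [c, a].Sublist p ∧ (b ∉ p ∨ [c, a, b].Sublist p)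
  found_or : ∀ c a b, a < b → b < c → [c, a].Sublist p → b ∉ p →
    s.found = true ∨ (a / B = b / B ∧ ∃ c', b / B < c' / B ∧ [c', a].Sublist p)
  found_of : ∀ c a b, a < b → b < c → [c, a, b].Sublist p → s.found = true

theorem sublist_append_singleton_iff {α : Type*} {l p : List α} {y x : α} :
    (l ++ [y]).Sublist (p ++ [x]) ↔ (l ++ [y]).Sublist p ∨ (y = x ∧ l.Sublist p) := by
  rw [← List.reverse_sublist, ← List.reverse_sublist (l₂ := p), ← List.reverse_sublist (l₁ := l)]
  simp only [List.reverse_append, List.reverse_cons, List.reverse_nil, List.nil_append,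
    List.singleton_append]
  constructor
  · intro h
    rcases List.cons_sublist_cons'.1 h with h | h
    · exact Or.inl h
    · exact Or.inr h
  · intro h
    exact List.cons_sublist_cons'.2 h

theorem pair_sublist_append_singleton_iff {p : List ℕ} {c a x : ℕ} :
    [c, a].Sublist (p ++ [x]) ↔ [c, a].Sublist p ∨ (a = x ∧ c ∈ p) := by
  simpa using sublist_append_singleton_iff (l := [c]) (y := a) (p := p) (x := x)

theorem triple_sublist_append_singleton_iff {p : List ℕ} {c a b x : ℕ} :
    [c, a, b].Sublist (p ++ [x]) ↔ [c, a, b].Sublist p ∨ (b = x ∧ [c, a].Sublist p) := by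
  simpa using sublist_append_singleton_iff (l := [c, a]) (y := b) (p := p) (x := x)

theorem card_filter_div_eq_le (B j : ℕ) (hB : 0 < B) (S : Finset ℕ) :
    (S.filter (· / B = j)).card ≤ B := by
  calc (S.filter (· / B = j)).card ≤ (Finset.Ico (j * B) ((j + 1) * B)).card := by
        refine Finset.card_le_card fun v hv => ?_
        rw [Finset.mem_filter, Nat.div_eq_iff hB] at hv
        rw [Finset.mem_Ico]
        have : (j + 1) * B = j * B + B := by ring
        omega
    _ = B := by simp [Nat.add_mul]

theorem card_filter_div_eq_lt {B v : ℕ} (hB : 0 < B) {S : Finset ℕ} (hv : v ∉ S) :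
    (S.filter (· / B = v / B)).card < B := by
  have h := card_filter_div_eq_le B (v / B) hB (insert v S)
  rw [Finset.filter_insert, if_pos rfl, Finset.card_insert_of_notMem (by simp [hv])] at h
  omega

theorem exists_notMem_of_card_filter_div_eq_lt {B j : ℕ} {S : Finset ℕ}
    (h : (S.filter (· / B = j)).card < B) : ∃ v, v / B = j ∧ v ∉ S := by
  by_contra! hc
  refine absurd h (not_lt.2 ?_)
  calc B = (Finset.Ico (j * B) ((j + 1) * B)).card := by simp [Nat.add_mul]
    _ ≤ _ := Finset.card_le_card fun v hv => by
      rw [Finset.mem_Ico] at hv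
      have : v / B = j := Nat.div_eq_of_lt_le hv.1 hv.2
      exact Finset.mem_filter.2 ⟨hc v this, this⟩

theorem BlockState.describes_start (n B K : ℕ) :
    (BlockState.start n K).Describes n B [] := by
  constructor <;> simp [BlockState.start] <;> (intros; omega)

theorem BlockState.Describes.step {n B K : ℕ} (hB : 0 < B) (hK : n / B < K) {s : BlockState K}
    {p : List ℕ} {x : ℕ} (h : s.Describes n B p) (hx : x ∉ p) (hxn : x ≤ n)
    (hpn : ∀ y ∈ p, y ≤ n) : (s.step B x).Describes n B (p ++ [x]) := by
  have htop : s.top ≤ n := by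
    rcases h.top_mem with h | h
    · exact hpn _ h
    · omega
  have htop_mem : ∀ {y}, y < s.top → s.top ∈ p := fun hy => h.top_mem.resolve_right (by omega)
  have hlt_of_div : ∀ {u v : ℕ}, u / B < v / B → u < v := fun {u v} huv => by
    by_contra! hvu
    exact absurd (Nat.div_le_div_right (c := B) hvu) (by omega)
  constructor
  case le_top =>
    intro y hy
    rcases List.mem_append.1 hy with hy | hy
    · exact le_max_of_le_left (h.le_top y hy)
    · exact le_max_of_le_right (List.mem_singleton.1 hy).le
  case top_mem =>
    simp only [BlockState.step, List.mem_append, List.mem_singleton]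
    have := h.top_mem
    rcases le_total s.top x with hm | hm
    · simp [max_eq_right hm]
    · rw [max_eq_left hm]; tauto
  case cnt_eq =>
    intro j
    simp only [BlockState.step, h.cnt_eq j, List.toFinset_append, List.toFinset_cons,
      List.toFinset_nil, insert_empty_eq]
    rw [Finset.union_comm, ← Finset.insert_eq, Finset.filter_insert]
    by_cases hj : x / B = j
    · rw [if_pos hj.symm, if_pos hj, Finset.card_insert_of_notMem (by simp [hx])]
    · rw [if_neg (Ne.symm hj), if_neg hj]
  case low_le =>
    intro j
    have := h.low_le j
    simp only [BlockState.step]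
    split_ifs <;> omega
  case of_low_lt =>
    intro j v hv hvn
    simp only [BlockState.step] at hv
    have hold : s.low j < v →
        ∃ c y, [c, y].Sublist (p ++ [x]) ∧ y / B = j ∧ y < v ∧ j < c / B := fun hv => by
      obtain ⟨c, y, h1, h2⟩ := h.of_low_lt j v hv hvn
      exact ⟨c, y, h1.trans (List.sublist_append_left ..), h2⟩
    split_ifs at hv with hj
    · rcases min_lt_iff.1 hv with hv | hv
      · exact hold hv
      · exact ⟨s.top, x, pair_sublist_append_singleton_iff.2
          (Or.inr ⟨rfl, htop_mem (hlt_of_div hj.2)⟩), hj.1.symm, hv, by omega⟩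
    · exact hold hv
  case low_le_of =>
    intro j c y hs hy hc
    simp only [BlockState.step]
    rcases pair_sublist_append_singleton_iff.1 hs with hs | ⟨rfl, hcp⟩
    · have := h.low_le_of j c y hs hy hc
      split_ifs <;> omega
    · have := Nat.div_le_div_right (c := B) (h.le_top c hcp)
      rw [if_pos (by omega)]
      omega
  case seen_subset =>
    have := h.seen_subset
    have hxB : x % B ∈ Finset.range B := Finset.mem_range.2 (Nat.mod_lt _ hB)
    simp only [BlockState.step]
    split_ifs
    · simpa using hxB
    · exact Finset.insert_subset hxB this
    · exact this
  case mem_seen =>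
    intro v hv
    have heq : ∀ {v}, v / B = x / B → (v % B = x % B ↔ v = x) := fun {v} hvx =>
      ⟨fun hm => by rw [← Nat.div_add_mod v B, ← Nat.div_add_mod x B, hvx, hm], fun e => by rw [e]⟩
    simp only [BlockState.step, List.mem_append, List.mem_singleton] at hv ⊢
    split_ifs with h1 h2
    · rw [max_eq_right (hlt_of_div h1).le] at hv
      rw [Finset.mem_singleton, heq hv]
      have : v ∉ p := fun hvp => by
        have := Nat.div_le_div_right (c := B) (h.le_top v hvp)
        omega
      tauto
    · have hv' : v / B = s.top / B := by
        rcases max_choice s.top x with e | e <;> rw [e] at hv <;> omega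
      rw [Finset.mem_insert, heq (by omega), h.mem_seen v hv']
      tauto
    · have hxt : x ≤ s.top := (hlt_of_div (show x / B < s.top / B by omega)).le
      rw [max_eq_left hxt] at hv
      rw [h.mem_seen v hv]
      have : v ≠ x := by rintro rfl; omega
      tauto
  case of_found =>
    intro hf
    simp only [BlockState.step, Bool.or_eq_true, decide_eq_true_eq] at hf
    have hnew : ∀ v, x < v → v < s.top → v ∉ p →
        ∃ c a b, a < b ∧ b < c ∧ [c, a].Sublist (p ++ [x]) ∧
          (b ∉ p ++ [x] ∨ [c, a, b].Sublist (p ++ [x])) := fun v h1 h2 h3 =>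
      ⟨s.top, x, v, h1, h2, pair_sublist_append_singleton_iff.2 (Or.inr ⟨rfl, htop_mem h2⟩),
        Or.inl (by simp [h3]; omega)⟩
    rcases hf with hf | ⟨hxt, ⟨j, hj1, hj2, hj3⟩ | ⟨v, hv1, hv2, hv3, hv4⟩ | ⟨hd, j, hj, hlow⟩⟩
    · obtain ⟨c, a, b, hab, hbc, hca, hb⟩ := h.of_found hf
      refine ⟨c, a, b, hab, hbc, hca.trans (List.sublist_append_left ..), ?_⟩
      rw [triple_sublist_append_singleton_iff]
      rcases hb with hb | hb
      · by_cases hbx : b = x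
        · exact Or.inr (Or.inr ⟨hbx, hca⟩)
        · exact Or.inl (by simp [hb, hbx])
      · exact Or.inr (Or.inl hb)
    · rw [h.cnt_eq] at hj3
      obtain ⟨v, hv, hvp⟩ := exists_notMem_of_card_filter_div_eq_lt hj3
      exact hnew v (hlt_of_div (by omega)) (hlt_of_div (by omega)) (by simpa using hvp)
    · exact hnew v hv1 hv2 fun hvp => hv4 ((h.mem_seen v hv3).2 hvp)
    · obtain ⟨c, y, hs, hy, hyx, hc⟩ := h.of_low_lt j x hlow hxn
      exact ⟨c, y, x, hyx, hlt_of_div (by omega), hs.trans (List.sublist_append_left ..),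
        Or.inr (triple_sublist_append_singleton_iff.2 (Or.inr ⟨rfl, hs⟩))⟩
  case found_or =>
    intro c a b hab hbc hs hbp
    simp only [List.mem_append, List.mem_singleton, not_or] at hbp
    rcases pair_sublist_append_singleton_iff.1 hs with hs | ⟨rfl, hcp⟩
    · rcases h.found_or c a b hab hbc hs hbp.1 with hf | ⟨e, c', hc', hs'⟩
      · exact Or.inl (by simp [BlockState.step, hf])
      · exact Or.inr ⟨e, c', hc', hs'.trans (List.sublist_append_left ..)⟩
    · have hct := h.le_top c hcp
      have h1 := Nat.div_le_div_right (c := B) hab.le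
      have h2 := Nat.div_le_div_right (c := B) (show b ≤ s.top by omega)
      have h3 := Nat.div_le_div_right (c := B) htop
      simp only [BlockState.step, Bool.or_eq_true, decide_eq_true_eq]
      by_cases hbt : b / B = s.top / B
      · exact Or.inl (Or.inr ⟨by omega, Or.inr (Or.inl ⟨b, hab, by omega, hbt,
          fun hb => hbp.1 ((h.mem_seen b hbt).1 hb)⟩)⟩)
      by_cases heq : a / B = b / B
      · exact Or.inr ⟨heq, s.top, by omega, pair_sublist_append_singleton_iff.2
          (Or.inr ⟨rfl, htop_mem (show b < s.top by omega)⟩)⟩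
      · refine Or.inl (Or.inr ⟨by omega, Or.inl ⟨⟨b / B, by omega⟩, ?_, ?_, ?_⟩⟩)
        · change a / B < b / B; omega
        · change b / B < s.top / B; omega
        · rw [h.cnt_eq]
          exact card_filter_div_eq_lt hB (by simpa using hbp.1)
  case found_of =>
    intro c a b hab hbc hs
    rcases triple_sublist_append_singleton_iff.1 hs with hs | ⟨rfl, hca⟩
    · simp [BlockState.step, h.found_of c a b hab hbc hs]
    · rcases h.found_or c a b hab hbc hca hx with hf | ⟨e, c', hc', hs'⟩
      · simp [BlockState.step, hf]
      · have hct := Nat.div_le_div_right (c := B) (h.le_top c' (hs'.subset (by simp)))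
        have h3 := Nat.div_le_div_right (c := B) htop
        simp only [BlockState.step, Bool.or_eq_true, decide_eq_true_eq]
        refine Or.inr ⟨hlt_of_div (by omega), Or.inr (Or.inr ⟨by omega, ⟨b / B, by omega⟩, rfl, ?_⟩)⟩
        exact lt_of_le_of_lt (h.low_le_of ⟨b / B, by omega⟩ c' a hs' e hc') hab

theorem BlockState.describes_foldl {n B K : ℕ} (hB : 0 < B) (hK : n / B < K) (p : List ℕ)
    (hp : IsDistinctSeqIn n p) :
    (p.foldl (BlockState.step B) (BlockState.start n K)).Describes n B p := by
  induction p using List.reverseRecOn with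
  | nil => exact BlockState.describes_start n B K
  | append_singleton p x ih =>
    have hp' : IsDistinctSeqIn n p :=
      ⟨(List.nodup_append.1 hp.1).1, fun y hy => hp.2 y (by simp [hy])⟩
    rw [List.foldl_append]
    refine (ih hp').step hB hK ?_ (hp.2 x (by simp)).2 fun y hy => (hp'.2 y hy).2
    intro hx
    exact (List.nodup_append.1 hp.1).2.2 x hx x (by simp) rfl

theorem BlockState.foldl_found_iff {n B K : ℕ} (hB : 0 < B) (hK : n / B < K) (τ : List ℕ)
    (hτ : IsPermOf n τ) :
    (τ.foldl (BlockState.step B) (BlockState.start n K)).found = true ↔ Contains τ [3, 1, 2] := by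
  have hd := hτ.isDistinctSeqIn
  have h := BlockState.describes_foldl hB hK τ hd
  rw [contains_312_iff]
  constructor
  · intro hf
    obtain ⟨c, a, b, hab, hbc, hca, hb⟩ := h.of_found hf
    refine ⟨c, a, b, hab, hbc, hb.resolve_left fun hb => hb (hτ.mem_iff.2 ?_)⟩
    have ha := hd.2 a (hca.subset (by simp))
    have hc := hd.2 c (hca.subset (by simp))
    rw [List.mem_range'_1]
    omega
  · rintro ⟨c, a, b, hab, hbc, hs⟩
    exact h.found_of c a b hab hbc hs

/-- Block states as tuples. -/
def BlockState.equivProd (K : ℕ) :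
    BlockState K ≃ Bool × ℕ × (Fin K → ℕ) × (Fin K → ℕ) × Finset ℕ where
  toFun s := (s.found, s.top, s.cnt, s.low, s.seen)
  invFun t := ⟨t.1, t.2.1, t.2.2.1, t.2.2.2.1, t.2.2.2.2⟩
  left_inv _ := rfl
  right_inv _ := rfl

/-- The block states that occur on repetition-free sequences from `[n]`. -/
def BlockState.bounded (n B K : ℕ) : Finset (BlockState K) :=
  ((Finset.univ : Finset Bool) ×ˢ Finset.range (n + 1) ×ˢ
    Fintype.piFinset (fun _ : Fin K => Finset.range (B + 1)) ×ˢ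
    Fintype.piFinset (fun _ : Fin K => Finset.range (n + 2)) ×ˢ
    (Finset.range B).powerset).map (BlockState.equivProd K).symm.toEmbedding

theorem BlockState.card_bounded (n B K : ℕ) :
    (BlockState.bounded n B K).card = 2 * ((n + 1) * ((B + 1) ^ K * ((n + 2) ^ K * 2 ^ B))) := by
  simp [BlockState.bounded, Finset.card_product]

theorem BlockState.Describes.mem_bounded {n B K : ℕ} (hB : 0 < B) {s : BlockState K} {p : List ℕ}
    (h : s.Describes n B p) (hp : IsDistinctSeqIn n p) : s ∈ BlockState.bounded n B K := by
  have htop : s.top ≤ n := by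
    rcases h.top_mem with h | h
    · exact (hp.2 _ h).2
    · omega
  rw [BlockState.bounded, Finset.mem_map_equiv]
  simp only [BlockState.equivProd, Equiv.symm_symm, Equiv.coe_fn_mk, Finset.mem_product,
    Finset.mem_univ, Finset.mem_range, Fintype.mem_piFinset, Finset.mem_powerset, true_and]
  refine ⟨by omega, fun j => ?_, fun j => ?_, h.seen_subset⟩
  · rw [h.cnt_eq j]
    exact Nat.lt_succ_of_le (card_filter_div_eq_le B j hB _)
  · have := h.low_le j
    omega

theorem exists_streamAlg_312 (n B : ℕ) (hB : 0 < B) :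
    ∃ (Q : Type) (inst : Fintype Q) (A : StreamAlg Q), SolvesPPM A n [3, 1, 2] ∧
      @Fintype.card Q inst =
        2 * ((n + 1) * ((B + 1) ^ (n / B + 1) * ((n + 2) ^ (n / B + 1) * 2 ^ B))) := by
  rw [← BlockState.card_bounded]
  exact exists_streamAlg_of_update (BlockState.step B) (BlockState.start n _) _
    {s | s.found = true} n _
    (fun p hp => (BlockState.describes_foldl hB (Nat.lt_succ_self _) p hp).mem_bounded hB hp)
    (fun τ hτ => BlockState.foldl_found_iff hB (Nat.lt_succ_self _) τ hτ)

theorem SolvesPPM.complement {Q : Type} {A : StreamAlg Q} {n : ℕ}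
    (h : SolvesPPM A n [3, 1, 2]) :
    SolvesPPM (⟨A.q0, A.F, fun q x => A.t q (n + 1 - x)⟩ : StreamAlg Q) n [1, 3, 2] := by
  intro τ hτ
  rw [← contains_map_complement_312_iff hτ, ← h _ (isPermOf_map_complement hτ)]
  simp [StreamAlg.Accepts, StreamAlg.run, List.foldl_map]

theorem card_states_le (n : ℕ) (hn : 2 ≤ n) (B : ℕ)
    (hB : B = ⌈Real.sqrt (n * Real.logb 2 n)⌉₊) :
    ((2 * ((n + 1) * ((B + 1) ^ (n / B + 1) * ((n + 2) ^ (n / B + 1) * 2 ^ B))) : ℕ) : ℝ) ≤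
      2 ^ (13 * Real.sqrt (n * Real.logb 2 n)) := by
  have hn' : (2 : ℝ) ≤ n := by exact_mod_cast hn
  set L := Real.logb 2 n with hL
  set r := Real.sqrt (n * L) with hr
  have hpow : (2 : ℝ) ^ L = n := Real.rpow_logb (by norm_num) (by norm_num) (by linarith)
  have hL1 : 1 ≤ L := by
    rw [hL, Real.le_logb_iff_rpow_le (by norm_num) (by linarith)]; simpa using hn'
  have hLn : L ≤ n := by
    rw [hL, Real.logb_le_iff_le_rpow (by norm_num) (by linarith), Real.rpow_natCast]
    exact_mod_cast Nat.lt_two_pow_self.le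
  have hrr : r * r = n * L := Real.mul_self_sqrt (by positivity)
  have hLr : L ≤ r := Real.le_sqrt_of_sq_le (by nlinarith)
  have hrn : r ≤ n := Real.sqrt_le_iff.2 ⟨by linarith, by nlinarith⟩
  have hr0 : 0 < r := by linarith
  have hrB : r ≤ B := by rw [hB]; exact Nat.le_ceil _
  have hBr : (B : ℝ) ≤ r + 1 := by rw [hB]; exact (Nat.ceil_lt_add_one hr0.le).le
  have hBn : B ≤ n := by rw [hB]; exact Nat.ceil_le.2 hrn
  have h1 : 2 * (n + 1) ≤ n ^ 3 := by
    nlinarith [Nat.mul_le_mul hn hn, Nat.mul_le_mul (Nat.mul_le_mul hn hn) hn]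
  have h2 : n + 2 ≤ n ^ 2 := by nlinarith
  have h3 : B + 1 ≤ n ^ 2 := by omega
  set K := n / B + 1 with hK
  have hnat : 2 * ((n + 1) * ((B + 1) ^ K * ((n + 2) ^ K * 2 ^ B))) ≤ n ^ (3 + 4 * K) * 2 ^ B := by
    calc _ = (2 * (n + 1)) * ((B + 1) ^ K * ((n + 2) ^ K * 2 ^ B)) := by ring
      _ ≤ n ^ 3 * ((n ^ 2) ^ K * ((n ^ 2) ^ K * 2 ^ B)) := by gcongr
      _ = _ := by rw [← pow_mul]; ring
  have hKr : (K : ℝ) * L ≤ r + L := by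
    have hdiv : ((n / B : ℕ) : ℝ) ≤ n / r :=
      Nat.cast_div_le.trans (div_le_div_of_nonneg_left (by positivity) hr0 hrB)
    have : (n / r : ℝ) * L = r := by field_simp; linarith
    rw [hK]
    push_cast
    nlinarith
  calc _ ≤ ((n ^ (3 + 4 * K) * 2 ^ B : ℕ) : ℝ) := by exact_mod_cast hnat
    _ = (2 : ℝ) ^ (L * (3 + 4 * K : ℕ) + B) := by
      rw [Real.rpow_add (by norm_num), Real.rpow_mul (by norm_num), hpow, Real.rpow_natCast,
        Real.rpow_natCast]
      push_cast
      rfl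
    _ ≤ _ := by
      refine Real.rpow_le_rpow_of_exponent_le (by norm_num) ?_
      push_cast
      nlinarith

/-- There is a constant `C` such that for every `n ≥ 2` and each
`π ∈ {312, 132}`, there is a deterministic single-pass streaming algorithm solving `π`-PPM_n
using at most `C·√(n·log₂ n)` bits of space, i.e. having at most `2^{C·√(n·log₂ n)}` states. -/
theorem stmt17 :
    ∃ C : ℝ, 0 < C ∧
      ∀ n : ℕ, 2 ≤ n →
        ∀ π : List ℕ, (π = [3, 1, 2] ∨ π = [1, 3, 2]) →
          ∃ (Q : Type) (inst : Fintype Q) (A : StreamAlg Q),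
            SolvesPPM A n π ∧
            (@Fintype.card Q inst : ℝ) ≤ 2 ^ (C * Real.sqrt (n * Real.logb 2 n)) := by
  refine ⟨13, by norm_num, fun n hn π hπ => ?_⟩
  have hn' : (2 : ℝ) ≤ n := by exact_mod_cast hn
  have hL : 0 < Real.logb 2 n := Real.logb_pos (by norm_num) (by linarith)
  obtain ⟨Q, inst, A, hA, hcard⟩ := exists_streamAlg_312 n ⌈Real.sqrt (n * Real.logb 2 n)⌉₊
    (Nat.ceil_pos.2 (Real.sqrt_pos.2 (by positivity)))
  have hle := card_states_le n hn _ rfl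
  rw [← hcard] at hle
  rcases hπ with rfl | rfl
  · exact ⟨Q, inst, A, hA, hle⟩
  · exact ⟨Q, inst, _, hA.complement, hle⟩
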